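/- Let Σ̄ be a d×d correlation matrix (symmetric positive definite with unit diagonal), let X be a random vector with density φ_d(·; Σ̄), let X′ be a standard normal random variable independent of X, let ε ∈ ℝ, and let X″ be a random variable independent of X with the law of X′ conditioned on X′ + ε > 0 (density φ(t) 1_{t > −ε} / Φ(ε)). Given δ ∈ (−1,1)^d, define Z ∈ ℝ^d by Z_i = √(1 − δ_i²) X_i + δ_i X″. Then Z has the extended skew-normal density φ_d(y; Ω̄) Φ(αᵀy + τ) / Φ( τ / √(1 + αᵀΩ̄α) ), where, with D_δ = diag(√(1 − δ_1²), …, √(1 − δ_d²)) and λ = D_δ⁻¹ δ: Ω̄ = D_δ ( Σ̄ + λλᵀ ) D_δ, α = (1 + λᵀ Σ̄⁻¹ λ)^{−1/2} D_δ⁻¹ Σ̄⁻¹ λ, and τ = (1 + αᵀΩ̄α)^{1/2} ε. In particular Ω̄ is a correlation matrix. -/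

import Mathlib

open MeasureTheory Real Filter Matrix Set Topology Asymptotics

noncomputable section

/-- Standard normal density. -/
def nPdf (x : ℝ) : ℝ := (Real.sqrt (2 * π))⁻¹ * Real.exp (-(x ^ 2) / 2)

/-- Standard normal distribution function. -/
def nCdf (x : ℝ) : ℝ := ∫ u in Set.Iio x, nPdf u

/-- Centred multivariate normal density with covariance matrix `S`. -/
def mvnPdf {ι : Type*} [Fintype ι] [DecidableEq ι] (S : Matrix ι ι ℝ) (y : ι → ℝ) : ℝ :=
  (2 * π) ^ (-(Fintype.card ι : ℝ) / 2) * S.det ^ (-(1 : ℝ) / 2) *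
    Real.exp (-(y ⬝ᵥ S⁻¹.mulVec y) / 2)

/-- Centred multivariate normal distribution function. -/
def mvnCdf {ι : Type*} [Fintype ι] [DecidableEq ι] (S : Matrix ι ι ℝ) (w : ι → ℝ) : ℝ :=
  ∫ u in Set.univ.pi fun i => Set.Iic (w i), mvnPdf S u

/-- Multivariate central Student-t density with scale matrix `S` and `ν` degrees of freedom. -/
def tPdf {ι : Type*} [Fintype ι] [DecidableEq ι] (S : Matrix ι ι ℝ) (ν : ℝ) (y : ι → ℝ) : ℝ :=
  Real.Gamma ((ν + Fintype.card ι) / 2) *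
      (1 + y ⬝ᵥ S⁻¹.mulVec y / ν) ^ (-(ν + Fintype.card ι) / 2) /
    (Real.Gamma (ν / 2) * (ν * π) ^ ((Fintype.card ι : ℝ) / 2) * Real.sqrt S.det)

/-- Univariate non-central t distribution function with non-centrality `a`. -/
def nctCdf (x a ν : ℝ) : ℝ :=
  ∫ v in Set.Ioi (0 : ℝ),
    v ^ (ν / 2 - 1) * Real.exp (-v) / Real.Gamma (ν / 2) *
      nCdf (x * Real.sqrt (2 * v / ν) - a)

/-- Multivariate non-central t distribution function. -/
def mvnctCdf {ι : Type*} [Fintype ι] [DecidableEq ι]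
    (y : ι → ℝ) (S : Matrix ι ι ℝ) (κ : ι → ℝ) (ν : ℝ) : ℝ :=
  ∫ v in Set.Ioi (0 : ℝ),
    v ^ (ν / 2 - 1) * Real.exp (-v) / Real.Gamma (ν / 2) *
      mvnCdf S fun i => y i * Real.sqrt (2 * v / ν) - κ i

/-- Multivariate non-central t density (scale-mixture form). -/
def mvnctPdf {ι : Type*} [Fintype ι] [DecidableEq ι]
    (μ : ι → ℝ) (S : Matrix ι ι ℝ) (κ : ι → ℝ) (ν : ℝ) (y : ι → ℝ) : ℝ :=
  ∫ v in Set.Ioi (0 : ℝ),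
    v ^ (ν / 2 - 1) * Real.exp (-v) / Real.Gamma (ν / 2) *
      ((2 * v / ν) ^ ((Fintype.card ι : ℝ) / 2) *
        mvnPdf S fun i => Real.sqrt (2 * v / ν) * (y i - μ i) - κ i)

/-- Univariate non-central t density with location `μ`, scale (standard deviation) `s`,
non-centrality `κ` and `ν` degrees of freedom. -/
def nctPdf1 (μ s κ ν x : ℝ) : ℝ :=
  ∫ v in Set.Ioi (0 : ℝ),
    v ^ (ν / 2 - 1) * Real.exp (-v) / Real.Gamma (ν / 2) *
      (Real.sqrt (2 * v / ν) * s⁻¹ * nPdf (Real.sqrt (2 * v / ν) * (x - μ) / s - κ))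

/-- Non-central extended skew-t density. -/
def skewTPdf {ι : Type*} [Fintype ι] [DecidableEq ι]
    (μ : ι → ℝ) (Ω : Matrix ι ι ℝ) (α : ι → ℝ) (τ κ ν : ℝ) (y : ι → ℝ) : ℝ :=
  let d : ℝ := Fintype.card ι
  let ω : Matrix ι ι ℝ := Matrix.diagonal fun i => Real.sqrt (Ω i i)
  let Ωb : Matrix ι ι ℝ := ω⁻¹ * Ω * ω⁻¹
  let z : ι → ℝ := ω⁻¹.mulVec fun i => y i - μ i
  let Q : ℝ := α ⬝ᵥ Ωb.mulVec α
  tPdf Ω ν (fun i => y i - μ i) *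
      nctCdf ((α ⬝ᵥ z + τ) * Real.sqrt ((ν + d) / (ν + z ⬝ᵥ Ωb⁻¹.mulVec z))) κ (ν + d) /
    nctCdf (τ / Real.sqrt (1 + Q)) (κ / Real.sqrt (1 + Q)) ν

/-- Non-central extended skew-t distribution function. -/
def skewTCdf {ι : Type*} [Fintype ι] [DecidableEq ι]
    (μ : ι → ℝ) (Ω : Matrix ι ι ℝ) (α : ι → ℝ) (τ κ ν : ℝ) (y : ι → ℝ) : ℝ :=
  ∫ u in Set.univ.pi fun i => Set.Iic (y i), skewTPdf μ Ω α τ κ ν u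


lemma nPdf_pos (x : ℝ) : 0 < nPdf x := by unfold nPdf; positivity

lemma nPdf_continuous : Continuous nPdf := by unfold nPdf; fun_prop

lemma nPdf_integrable : Integrable nPdf := by
  have := (integrable_exp_neg_mul_sq (b := 1/2) (by norm_num)).const_mul (Real.sqrt (2 * π))⁻¹
  refine this.congr (ae_of_all _ fun x => ?_)
  simp only [nPdf]
  congr 2; ring

lemma nPdf_neg (x : ℝ) : nPdf (-x) = nPdf x := by simp [nPdf]

lemma nCdf_nonneg (x : ℝ) : 0 ≤ nCdf x := by
  unfold nCdf
  exact integral_nonneg fun u => (nPdf_pos u).le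

lemma nCdf_pos (x : ℝ) : 0 < nCdf x := by
  unfold nCdf
  rw [setIntegral_pos_iff_support_of_nonneg_ae]
  · have : Function.support nPdf = univ := by
      ext u; simp [(nPdf_pos u).ne']
    rw [this, univ_inter]; simp
  · exact ae_of_all _ fun u => (nPdf_pos u).le
  · exact nPdf_integrable.integrableOn

lemma nPdf_scaled_lintegral (a b ε : ℝ) (ha : 0 < a) :
    ∫⁻ t : ℝ, ENNReal.ofReal (if -ε < t then nPdf (a * t - b) else 0)
      = ENNReal.ofReal (a⁻¹ * nCdf (a * ε + b)) := by
  set g : ℝ → ℝ := (Iio (a * ε + b)).indicator nPdf with hg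
  have hgi : Integrable g := nPdf_integrable.indicator measurableSet_Iio
  have hfun : (fun t : ℝ => if -ε < t then nPdf (a * t - b) else 0)
      = fun t => (fun u => g (b + u)) ((-a) * t) := by
    ext t
    have : b + -a * t < a * ε + b ↔ -ε < t := by
      constructor
      · intro h; nlinarith
      · intro h; nlinarith
    simp only [hg, indicator, mem_Iio, this]
    split_ifs
    · rw [← nPdf_neg]; congr 1; ring
    · rfl
  have hi : Integrable (fun t : ℝ => if -ε < t then nPdf (a * t - b) else 0) := by
    rw [hfun]
    exact (hgi.comp_add_left b).comp_mul_left' (neg_ne_zero.2 ha.ne')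
  rw [← ofReal_integral_eq_lintegral_ofReal hi]
  · congr 1
    rw [hfun, Measure.integral_comp_mul_left (fun u => g (b + u)), integral_add_left_eq_self g b, hg,
      integral_indicator measurableSet_Iio, inv_neg, abs_neg, abs_of_pos (by positivity)]
    rfl
  · refine ae_of_all _ fun t => ?_
    dsimp only [Pi.zero_apply]
    split_ifs
    · exact (nPdf_pos _).le
    · exact le_rfl

section alg
variable {d : ℕ} {S : Matrix (Fin d) (Fin d) ℝ}

lemma c_pos (hS : S.PosDef) (l : Fin d → ℝ) : 0 < 1 + l ⬝ᵥ S⁻¹.mulVec l := by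
  have := hS.inv.posSemidef.dotProduct_mulVec_nonneg l
  simp only [star_trivial] at this
  linarith

lemma symm_form (hS : S.PosDef) (v w : Fin d → ℝ) :
    v ⬝ᵥ S⁻¹.mulVec w = w ⬝ᵥ S⁻¹.mulVec v := by
  have h : (S⁻¹)ᵀ = S⁻¹ := by
    have := hS.inv.isHermitian.eq
    rwa [conjTranspose_eq_transpose_of_trivial] at this
  rw [dotProduct_comm, ← vecMul_transpose, h, dotProduct_mulVec]

lemma M_posDef (hS : S.PosDef) (l : Fin d → ℝ) : (S + vecMulVec l l).PosDef := by
  have := posSemidef_vecMulVec_self_star l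
  simp only [star_trivial] at this
  exact hS.add_posSemidef this

lemma M_det (hS : S.PosDef) (l : Fin d → ℝ) :
    (S + vecMulVec l l).det = S.det * (1 + l ⬝ᵥ S⁻¹.mulVec l) := by
  rw [vecMulVec_eq Unit, det_add_replicateCol_mul_replicateRow hS.det_pos.ne'.isUnit]
  congr 1
  rw [det_unique]
  rw [dotProduct_mulVec]
  simp [Matrix.mul_apply, vecMul, dotProduct]

lemma M_form (hS : S.PosDef) (l w : Fin d → ℝ) :
    w ⬝ᵥ (S + vecMulVec l l)⁻¹.mulVec w
      = w ⬝ᵥ S⁻¹.mulVec w - (l ⬝ᵥ S⁻¹.mulVec w) ^ 2 / (1 + l ⬝ᵥ S⁻¹.mulVec l) := by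
  have hc := c_pos hS l
  have hu : IsUnit S.det := hS.det_pos.ne'.isUnit
  have huM : IsUnit (S + vecMulVec l l).det := (M_posDef hS l).det_pos.ne'.isUnit
  set c := 1 + l ⬝ᵥ S⁻¹.mulVec l with hcdef
  set b := l ⬝ᵥ S⁻¹.mulVec w with hb
  have key : (S + vecMulVec l l).mulVec (S⁻¹.mulVec w - (b / c) • S⁻¹.mulVec l) = w := by
    rw [add_mulVec, mulVec_sub, mulVec_smul, mulVec_mulVec, mulVec_mulVec,
      mul_nonsing_inv _ hu, one_mulVec, one_mulVec, vecMulVec_mulVec, dotProduct_sub,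
      dotProduct_smul, ← hb, show l ⬝ᵥ S⁻¹.mulVec l = c - 1 by rw [hcdef]; ring]
    ext i
    simp
    field_simp
    ring
  have : (S + vecMulVec l l)⁻¹.mulVec w = S⁻¹.mulVec w - (b / c) • S⁻¹.mulVec l := by
    conv_lhs => rw [← key]
    rw [mulVec_mulVec, nonsing_inv_mul _ huM, one_mulVec]
  rw [this, dotProduct_sub, dotProduct_smul, symm_form hS w l, ← hb, smul_eq_mul]
  ring

lemma diag_inv {s : Fin d → ℝ} (hs : ∀ i, 0 < s i) :
    (diagonal s)⁻¹ = diagonal (fun i => (s i)⁻¹) := by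
  apply inv_eq_right_inv
  rw [diagonal_mul_diagonal, ← diagonal_one]
  congr 1; ext i; exact mul_inv_cancel₀ (hs i).ne'

lemma Om_posDef (hS : S.PosDef) {s : Fin d → ℝ} (hs : ∀ i, 0 < s i) (l : Fin d → ℝ) :
    (diagonal s * (S + vecMulVec l l) * diagonal s).PosDef := by
  have hD : IsUnit (diagonal s) := by
    rw [isUnit_iff_isUnit_det, det_diagonal]
    exact (Finset.prod_pos fun i _ => hs i).ne'.isUnit
  have := (Matrix.IsUnit.posDef_star_left_conjugate_iff (x := S + vecMulVec l l) hD).2 (M_posDef hS l)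
  simpa [star_eq_conjTranspose] using this

lemma mvn_Om (hS : S.PosDef) {s : Fin d → ℝ} (hs : ∀ i, 0 < s i) (l w : Fin d → ℝ) (t : ℝ) :
    mvnPdf S (w - t • l) * nPdf t =
      (∏ i, s i) * mvnPdf (diagonal s * (S + vecMulVec l l) * diagonal s) (fun i => s i * w i) *
       Real.sqrt (1 + l ⬝ᵥ S⁻¹.mulVec l) *
      nPdf (Real.sqrt (1 + l ⬝ᵥ S⁻¹.mulVec l) * t
        - (l ⬝ᵥ S⁻¹.mulVec w) / Real.sqrt (1 + l ⬝ᵥ S⁻¹.mulVec l)) := by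
  have hc := c_pos hS l
  have hdS := hS.det_pos
  have hP : 0 < ∏ i, s i := Finset.prod_pos fun i _ => hs i
  have hdet : (diagonal s * (S + vecMulVec l l) * diagonal s).det
      = (∏ i, s i) ^ 2 * ((1 + l ⬝ᵥ S⁻¹.mulVec l) * S.det) := by
    rw [det_mul, det_mul, det_diagonal, M_det hS]; ring
  have hform : (fun i => s i * w i) ⬝ᵥ
      (diagonal s * (S + vecMulVec l l) * diagonal s)⁻¹.mulVec (fun i => s i * w i)
      = w ⬝ᵥ S⁻¹.mulVec w - (l ⬝ᵥ S⁻¹.mulVec w) ^ 2 / (1 + l ⬝ᵥ S⁻¹.mulVec l) := by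
    rw [← M_form hS, Matrix.mul_inv_rev, Matrix.mul_inv_rev, diag_inv hs, ← mulVec_mulVec,
      ← mulVec_mulVec]
    have h1 : (diagonal fun i => (s i)⁻¹).mulVec (fun i => s i * w i) = w := by
      ext i; rw [mulVec_diagonal]; field_simp [(hs i).ne']
    rw [h1]
    simp only [dotProduct, mulVec_diagonal]
    refine Finset.sum_congr rfl fun i _ => ?_
    have := (hs i).ne'
    field_simp
  have hq : (w - t • l) ⬝ᵥ S⁻¹.mulVec (w - t • l) =
      w ⬝ᵥ S⁻¹.mulVec w - 2 * t * (l ⬝ᵥ S⁻¹.mulVec w) + t ^ 2 * (l ⬝ᵥ S⁻¹.mulVec l) := by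
    rw [mulVec_sub, mulVec_smul, sub_dotProduct, dotProduct_sub, dotProduct_sub, dotProduct_smul,
      smul_dotProduct, smul_dotProduct, dotProduct_smul, symm_form hS w l]
    simp only [smul_eq_mul]; ring
  have hpow : ((∏ i, s i) ^ 2 * ((1 + l ⬝ᵥ S⁻¹.mulVec l) * S.det)) ^ (-(1:ℝ)/2)
      = (∏ i, s i)⁻¹ * ((Real.sqrt (1 + l ⬝ᵥ S⁻¹.mulVec l))⁻¹ * S.det ^ (-(1:ℝ)/2)) := by
    rw [mul_rpow (by positivity) (by positivity), mul_rpow hc.le hdS.le, ← rpow_natCast,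
      ← rpow_mul hP.le, sqrt_eq_rpow, ← rpow_neg hc.le, ← rpow_neg_one]
    norm_num
  unfold mvnPdf nPdf
  rw [hform, hq, hdet, hpow]
  set c := 1 + l ⬝ᵥ S⁻¹.mulVec l with hcdef
  rw [show l ⬝ᵥ S⁻¹.mulVec l = c - 1 by rw [hcdef]; ring]
  set b := l ⬝ᵥ S⁻¹.mulVec w
  set q := w ⬝ᵥ S⁻¹.mulVec w
  have hsc : 0 < Real.sqrt c := Real.sqrt_pos.2 hc
  have hexp : rexp (-(q - 2 * t * b + t ^ 2 * (c - 1)) / 2) * rexp (-t ^ 2 / 2)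
      = rexp (-(q - b ^ 2 / c) / 2) * rexp (-(Real.sqrt c * t - b / Real.sqrt c) ^ 2 / 2) := by
    rw [← Real.exp_add, ← Real.exp_add]
    congr 1
    have h2 : (Real.sqrt c * t - b / Real.sqrt c) ^ 2 = c * t ^ 2 - 2 * t * b + b ^ 2 / c := by
      have h3 := Real.sq_sqrt hc.le
      rw [sub_sq, mul_pow, div_pow, h3]
      field_simp
    rw [h2]; ring
  generalize (2 * π) ^ (-(Fintype.card (Fin d) : ℝ) / 2) = K
  generalize S.det ^ (-(1:ℝ) / 2) = e
  calc _ = K * e * (Real.sqrt (2 * π))⁻¹ * (rexp (-(q - 2 * t * b + t ^ 2 * (c - 1)) / 2) * rexp (-t ^ 2 / 2)) := by ring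
    _ = _ := by
      rw [hexp]
      field_simp

lemma mvnPdf_nonneg (hS : S.PosDef) (y) : 0 ≤ mvnPdf S y := by
  have := hS.det_pos
  unfold mvnPdf; positivity

lemma mvnPdf_continuous : Continuous (mvnPdf S) := by
  unfold mvnPdf
  have : Continuous fun y : Fin d → ℝ => S⁻¹.mulVec y := by fun_prop
  fun_prop

lemma inner_int (hS : S.PosDef) {s : Fin d → ℝ} (hs : ∀ i, 0 < s i) (l w : Fin d → ℝ) (ε : ℝ) :
    ∫⁻ t : ℝ, ENNReal.ofReal (∏ i, s i)⁻¹ * ENNReal.ofReal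
      (mvnPdf S (w - t • l) * if -ε < t then nPdf t / nCdf ε else 0)
    = ENNReal.ofReal (mvnPdf (diagonal s * (S + vecMulVec l l) * diagonal s) (fun i => s i * w i) *
       nCdf ((l ⬝ᵥ S⁻¹.mulVec w) / Real.sqrt (1 + l ⬝ᵥ S⁻¹.mulVec l)
         + Real.sqrt (1 + l ⬝ᵥ S⁻¹.mulVec l) * ε) / nCdf ε) := by
  have hP : 0 < ∏ i, s i := Finset.prod_pos fun i _ => hs i
  have hsc : 0 < Real.sqrt (1 + l ⬝ᵥ S⁻¹.mulVec l) := Real.sqrt_pos.2 (c_pos hS l)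
  have hm := mvnPdf_nonneg (Om_posDef hS hs l) (fun i => s i * w i)
  have hn := nCdf_pos ε
  have hpt := mvn_Om hS hs l w
  set m := mvnPdf (diagonal s * (S + vecMulVec l l) * diagonal s) (fun i => s i * w i)
  set a := Real.sqrt (1 + l ⬝ᵥ S⁻¹.mulVec l)
  set b := l ⬝ᵥ S⁻¹.mulVec w
  have : ∀ t : ℝ, ENNReal.ofReal (∏ i, s i)⁻¹ * ENNReal.ofReal
      (mvnPdf S (w - t • l) * if -ε < t then nPdf t / nCdf ε else 0)
      = ENNReal.ofReal (m * a / nCdf ε) *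
        ENNReal.ofReal (if -ε < t then nPdf (a * t - b / a) else 0) := by
    intro t
    rw [← ENNReal.ofReal_mul (by positivity), ← ENNReal.ofReal_mul (by positivity)]
    congr 1
    split_ifs
    · rw [mul_div_assoc', hpt t]; field_simp
    · simp
  simp_rw [this]
  rw [lintegral_const_mul' _ _ ENNReal.ofReal_ne_top, nPdf_scaled_lintegral _ _ _ hsc,
    ← ENNReal.ofReal_mul (by positivity), add_comm (a * ε)]
  congr 1
  field_simp

lemma affine_lintegral {s : Fin d → ℝ} (hs : ∀ i, 0 < s i) (v : Fin d → ℝ)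
    (G : (Fin d → ℝ) → ENNReal) (hG : Measurable G) :
    ∫⁻ x : Fin d → ℝ, G (fun i => s i * x i + v i) = ∫⁻ y, ENNReal.ofReal (∏ i, s i)⁻¹ * G y := by
  have hP : 0 < ∏ i, s i := Finset.prod_pos fun i _ => hs i
  have h := Real.map_matrix_volume_pi_eq_smul_volume_pi (M := diagonal s)
    (by rw [det_diagonal]; exact hP.ne')
  rw [det_diagonal, abs_of_pos (by positivity)] at h
  have hmeas : Measurable (toLin' (diagonal s)) :=
    Continuous.measurable (LinearMap.continuous_on_pi _)
  have h1 : ∫⁻ x : Fin d → ℝ, G (fun i => s i * x i + v i)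
      = ∫⁻ y, G (y + v) ∂(Measure.map (toLin' (diagonal s)) volume) := by
    rw [lintegral_map (f := fun y => G (y + v)) (hG.comp (measurable_add_const v)) hmeas]
    congr 1; ext x; congr 1; ext i
    simp [mulVec_diagonal]
  rw [h1, h, lintegral_smul_measure, lintegral_add_right_eq_self G v,
    lintegral_const_mul' _ _ ENNReal.ofReal_ne_top, smul_eq_mul]

lemma core (hS : S.PosDef) {s : Fin d → ℝ} (hs : ∀ i, 0 < s i) (δ : Fin d → ℝ) (ε : ℝ) :
    Measure.map (fun (p : (Fin d → ℝ) × ℝ) i => s i * p.1 i + δ i * p.2)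
      (volume.withDensity fun p => ENNReal.ofReal
      (mvnPdf S p.1 * if -ε < p.2 then nPdf p.2 / nCdf ε else 0)) =
    volume.withDensity (fun y => ∫⁻ t : ℝ, ENNReal.ofReal (∏ i, s i)⁻¹ * ENNReal.ofReal
      (mvnPdf S ((fun i => (s i)⁻¹ * y i) - t • (fun i => (s i)⁻¹ * δ i)) *
        if -ε < t then nPdf t / nCdf ε else 0)) := by
  set f : (Fin d → ℝ) × ℝ → ENNReal := fun p => ENNReal.ofReal
      (mvnPdf S p.1 * if -ε < p.2 then nPdf p.2 / nCdf ε else 0) with hf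
  have hfm : Measurable f := by
    refine Measurable.ennreal_ofReal (Measurable.mul
      (mvnPdf_continuous.measurable.comp measurable_fst) ?_)
    refine Measurable.ite (measurableSet_lt measurable_const measurable_snd) ?_ measurable_const
    exact (nPdf_continuous.measurable.comp measurable_snd).div_const _
  have hT : Measurable (fun (p : (Fin d → ℝ) × ℝ) i => s i * p.1 i + δ i * p.2) := by
    fun_prop
  have hR : Measurable (fun (p : (Fin d → ℝ) × ℝ) =>
      (((fun i => (s i)⁻¹ * p.1 i) - p.2 • (fun i => (s i)⁻¹ * δ i), p.2) : (Fin d → ℝ) × ℝ)) := by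
    fun_prop
  ext A hA
  rw [Measure.map_apply hT hA, withDensity_apply _ (hT hA), withDensity_apply _ hA,
    ← lintegral_indicator (hT hA), ← lintegral_indicator hA, Measure.volume_eq_prod,
    lintegral_prod_symm' _ (hfm.indicator (hT hA))]
  have step : ∀ t : ℝ, ∫⁻ x : Fin d → ℝ,
      ((fun (p : (Fin d → ℝ) × ℝ) i => s i * p.1 i + δ i * p.2) ⁻¹' A).indicator f (x, t)
      = ∫⁻ y : Fin d → ℝ, ENNReal.ofReal (∏ i, s i)⁻¹ * A.indicator (fun y =>
        f ((fun i => (s i)⁻¹ * y i) - t • (fun i => (s i)⁻¹ * δ i), t)) y := by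
    intro t
    rw [← affine_lintegral hs (fun i => δ i * t)]
    · congr 1; ext x
      have : ((fun i => (s i)⁻¹ * (s i * x i + δ i * t)) - t • (fun i => (s i)⁻¹ * δ i)) = x := by
        ext i
        have := (hs i).ne'
        simp
        field_simp
        ring
      simp only [indicator, this]
      rfl
    · refine Measurable.indicator ?_ hA
      exact hfm.comp (hR.comp (measurable_id.prodMk measurable_const))
  simp_rw [step]
  rw [lintegral_lintegral_swap]
  · congr 1; ext y
    by_cases hy : y ∈ A
    · simp [hy, hf]
    · simp [hy]
  · apply Measurable.aemeasurable
    refine Measurable.const_mul ?_ _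
    have : (Function.uncurry fun (t : ℝ) (y : Fin d → ℝ) => A.indicator (fun y =>
        f ((fun i => (s i)⁻¹ * y i) - t • (fun i => (s i)⁻¹ * δ i), t)) y)
        = (Prod.snd ⁻¹' A).indicator (fun q : ℝ × (Fin d → ℝ) =>
          f ((fun i => (s i)⁻¹ * q.2 i) - q.1 • (fun i => (s i)⁻¹ * δ i), q.1)) := by
      ext q
      by_cases hq : q.2 ∈ A <;> simp [hq, Function.uncurry]
    change Measurable (Function.uncurry fun (t : ℝ) (y : Fin d → ℝ) => A.indicator (fun y =>
        f ((fun i => (s i)⁻¹ * y i) - t • (fun i => (s i)⁻¹ * δ i), t)) y)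
    rw [this]
    exact Measurable.indicator (hfm.comp (hR.comp measurable_swap)) (measurable_snd hA)

end alg

/-- additive-type stochastic representation of the extended skew-normal
distribution: the transformed vector `Z` has extended skew-normal law with the stated
parameters, and the resulting `Ω̄` is a correlation matrix. -/
theorem skewNormal_additive_representation
    (d : ℕ) (Sb : Matrix (Fin d) (Fin d) ℝ) (hpd : Sb.PosDef)
    (hSdiag : ∀ i, Sb i i = 1) (ε : ℝ) (δ : Fin d → ℝ)
    (hδ : ∀ i, δ i ∈ Set.Ioo (-1 : ℝ) 1)
    (μ : Measure ((Fin d → ℝ) × ℝ))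
    (hμ : μ = volume.withDensity fun p => ENNReal.ofReal
      (mvnPdf Sb p.1 * if -ε < p.2 then nPdf p.2 / nCdf ε else 0)) :
    let T : (Fin d → ℝ) × ℝ → (Fin d → ℝ) := fun p i =>
      Real.sqrt (1 - δ i ^ 2) * p.1 i + δ i * p.2
    let Dδ : Matrix (Fin d) (Fin d) ℝ := Matrix.diagonal fun i => Real.sqrt (1 - δ i ^ 2)
    let lam : Fin d → ℝ := Dδ⁻¹.mulVec δ
    let Ωb : Matrix (Fin d) (Fin d) ℝ := Dδ * (Sb + Matrix.vecMulVec lam lam) * Dδ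
    let αv : Fin d → ℝ :=
      (Real.sqrt (1 + lam ⬝ᵥ Sb⁻¹.mulVec lam))⁻¹ • Dδ⁻¹.mulVec (Sb⁻¹.mulVec lam)
    let τv : ℝ := Real.sqrt (1 + αv ⬝ᵥ Ωb.mulVec αv) * ε
    Measure.map T μ = volume.withDensity (fun y => ENNReal.ofReal
      (mvnPdf Ωb y * nCdf (αv ⬝ᵥ y + τv) /
        nCdf (τv / Real.sqrt (1 + αv ⬝ᵥ Ωb.mulVec αv)))) ∧
    Ωb.PosDef ∧ ∀ i, Ωb i i = 1 := by
  intro T Dδ lam Ωb αv τv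
  have hs : ∀ i, 0 < Real.sqrt (1 - δ i ^ 2) := fun i => by
    apply Real.sqrt_pos.2
    have := hδ i
    nlinarith [this.1, this.2]
  have hlam : lam = fun i => (Real.sqrt (1 - δ i ^ 2))⁻¹ * δ i := by
    ext i
    simp only [lam, Dδ, diag_inv hs, mulVec_diagonal]
  have hc := c_pos hpd lam
  have hsc := Real.sqrt_pos.2 hc
  have hu : IsUnit Sb.det := hpd.det_pos.ne'.isUnit
  have hDα : Dδ.mulVec αv =
      (Real.sqrt (1 + lam ⬝ᵥ Sb⁻¹.mulVec lam))⁻¹ • Sb⁻¹.mulVec lam := by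
    ext i
    have := (hs i).ne'
    simp only [αv, Dδ, diag_inv hs, mulVec_diagonal, Pi.smul_apply, smul_eq_mul]
    field_simp
  have hq : αv ⬝ᵥ Ωb.mulVec αv = lam ⬝ᵥ Sb⁻¹.mulVec lam := by
    have h1 : αv ⬝ᵥ Ωb.mulVec αv
        = Dδ.mulVec αv ⬝ᵥ (Sb + vecMulVec lam lam).mulVec (Dδ.mulVec αv) := by
      simp only [Ωb]
      rw [← mulVec_mulVec, ← mulVec_mulVec, dotProduct_mulVec, ← mulVec_transpose]
      simp only [Dδ, diagonal_transpose]
    rw [h1, hDα, mulVec_smul, add_mulVec, mulVec_mulVec lam Sb, mul_nonsing_inv _ hu, one_mulVec,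
      vecMulVec_mulVec, smul_dotProduct, dotProduct_smul, dotProduct_add, dotProduct_comm _ lam]
    have h2 := Real.sq_sqrt hc.le
    set a := Real.sqrt (1 + lam ⬝ᵥ Sb⁻¹.mulVec lam)
    set k := lam ⬝ᵥ Sb⁻¹.mulVec lam
    have h3 : (Sb⁻¹.mulVec lam) ⬝ᵥ (MulOpposite.op k • lam) = k * k := by
      rw [op_smul_eq_smul, dotProduct_smul, dotProduct_comm, smul_eq_mul]
    rw [h3]
    simp only [smul_eq_mul]
    field_simp
    rw [h2]; ring
  have hΩ : Ωb.PosDef := Om_posDef hpd hs lam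
  refine ⟨?_, hΩ, ?_⟩
  · rw [hμ]
    refine (core hpd hs δ ε).trans ?_
    congr 1; ext y
    rw [inner_int hpd hs, ← hlam]
    have hy : (fun i => Real.sqrt (1 - δ i ^ 2) * ((Real.sqrt (1 - δ i ^ 2))⁻¹ * y i)) = y := by
      ext i
      have := (hs i).ne'
      field_simp
    rw [hy]
    have hα : αv ⬝ᵥ y = lam ⬝ᵥ Sb⁻¹.mulVec (fun i => (Real.sqrt (1 - δ i ^ 2))⁻¹ * y i) /
        Real.sqrt (1 + lam ⬝ᵥ Sb⁻¹.mulVec lam) := by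
      rw [symm_form hpd lam]
      simp only [αv, Dδ, diag_inv hs, smul_dotProduct, smul_eq_mul]
      rw [inv_mul_eq_div]
      congr 1
      simp only [dotProduct, mulVec_diagonal]
      exact Finset.sum_congr rfl fun i _ => by ring
    have hτ : τv / Real.sqrt (1 + αv ⬝ᵥ Ωb.mulVec αv) = ε := by
      simp only [τv, hq]
      field_simp
    rw [hτ, hα]
    simp only [τv, hq]
    rfl
  · intro i
    have h2 := Real.sq_sqrt (Real.sqrt_pos.1 (hs i)).le
    have h3 := (hs i).ne'
    simp only [Ωb, Dδ, mul_diagonal, diagonal_mul, Matrix.add_apply, vecMulVec_apply, hSdiag, hlam]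
    field_simp
    rw [h2]; ring
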